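/- Fix K ∈ ℕ and let f: P → ⊕_{k=0}^K S^k ℝ^m ⊗ Hom(V₁,V₂) be smooth and infinitesimally G₀-equivariant with respect to ⊕_k σ^(k). Then the function N^ω f := −2 Σ_{i=1}^m γ(εⁱ)(L_{ω^{-1}(eᵢ)}f) is again infinitesimally G₀-equivariant with respect to ⊕_k σ^(k). -/

import Mathlib

open scoped BigOperators
noncomputable section
namespace ProjQuant

/-- `ℝ^m`. -/
abbrev Rm (m : ℕ) := Fin m → ℝ

/-- The index set for `(m+1) × (m+1)` matrices, split into blocks. -/
abbrev Idx (m : ℕ) := Sum (Fin m) Unit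

/-- `gl(m,ℝ)`, realized as continuous linear endomorphisms of `ℝ^m`. -/
abbrev GLm (m : ℕ) := (Fin m → ℝ) →L[ℝ] (Fin m → ℝ)

/-- `ℝ^{m*}`. -/
abbrev Dualm (m : ℕ) := (Fin m → ℝ) →L[ℝ] ℝ

/-- The vector field `X^M` on `ℝ^m` attached to a matrix
`M = [[A, v], [ξ, a]] ∈ sl(m+1,ℝ)`, namely `X^M(x) = -v - A x + a x + ξ(x) x`. -/
def projVF (m : ℕ) (M : Matrix (Idx m) (Idx m) ℝ) : Rm m → Rm m := fun x i =>
  -(M (Sum.inl i) (Sum.inr ())) - (∑ j, M (Sum.inl i) (Sum.inl j) * x j)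
    + M (Sum.inr ()) (Sum.inr ()) * x i
    + (∑ j, M (Sum.inr ()) (Sum.inl j) * x j) * x i

/-- The Lie derivative of a `V`-valued function along a vector field `X`, with respect to a
representation `σ` of `gl(m,ℝ)` on `V`:  `(L_X f)(x) = Df(x)[X(x)] - σ(DX(x))(f(x))`. -/
def lieD (m : ℕ) {V : Type} [NormedAddCommGroup V] [NormedSpace ℝ V]
    (σ : GLm m → V → V) (X : Rm m → Rm m) (f : Rm m → V) : Rm m → V :=
  fun x => fderiv ℝ f x (X x) - σ (fderiv ℝ X x) (f x)

/-- `σ` is a Lie algebra representation of `gl(m,ℝ)`. -/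
def IsLieRep (m : ℕ) {V : Type} [NormedAddCommGroup V] [NormedSpace ℝ V]
    (σ : GLm m →ₗ[ℝ] (V →L[ℝ] V)) : Prop :=
  ∀ A B : GLm m, σ (A ∘L B - B ∘L A) = σ A ∘L σ B - σ B ∘L σ A


/-- Iterated Lie derivative along the constant fields `X^{hᵢ} = -hᵢ`, outermost first. -/
def lieItC (m : ℕ) {V : Type} [NormedAddCommGroup V] [NormedSpace ℝ V]
    (σ : GLm m → V → V) : (k : ℕ) → (Fin k → Rm m) → (Rm m → V) → (Rm m → V)
  | 0, _, f => f
  | (k+1), v, f => lieD m σ (fun _ => -(v 0)) (lieItC m σ k (fun j => v j.succ) f)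

section Symbols

variable (m : ℕ) (V₁ V₂ : Type)
  [NormedAddCommGroup V₁] [NormedSpace ℝ V₁] [NormedAddCommGroup V₂] [NormedSpace ℝ V₂]

/-- The model for `S^k ℝ^m ⊗ Hom(V₁,V₂)`: multilinear maps on `k` copies of `ℝ^{m*}`
with values in `Hom(V₁,V₂)` (symbols of degree `k` are the symmetric ones). -/
abbrev Symb (k : ℕ) := ContinuousMultilinearMap ℝ (fun _ : Fin k => Dualm m) (V₁ →L[ℝ] V₂)

/-- The decomposable tensor `h₁ ⊗ ⋯ ⊗ h_k ⊗ A` in the model. -/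
def pureT {k : ℕ} (v : Fin k → Rm m) (A : V₁ →L[ℝ] V₂) : Symb m V₁ V₂ k :=
  (ContinuousMultilinearMap.mkPiRing ℝ (Fin k) A).compContinuousLinearMap
    (fun i => ContinuousLinearMap.apply ℝ ℝ (v i))

/-- The symmetric product `h₁ ∨ ⋯ ∨ h_k ⊗ A` in the model. -/
def symT {k : ℕ} (v : Fin k → Rm m) (A : V₁ →L[ℝ] V₂) : Symb m V₁ V₂ k :=
  ∑ ν : Equiv.Perm (Fin k), pureT m V₁ V₂ (v ∘ ν) A

/-- The subspace of the model corresponding to `S^k ℝ^m ⊗ Hom(V₁,V₂)` itself: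
the span of the symmetric products. -/
def spanGen (k : ℕ) : Submodule ℝ (Symb m V₁ V₂ k) :=
  Submodule.span ℝ {T | ∃ (v : Fin k → Rm m) (A : V₁ →L[ℝ] V₂), T = symT m V₁ V₂ v A}

/-- The rank-one endomorphism `u ⊗ h : x ↦ h(x) • u` of `ℝ^m`. -/
def rkOne (u : Rm m) (h : Dualm m) : GLm m := h.smulRight u

variable (σ₁ : GLm m →ₗ[ℝ] (V₁ →L[ℝ] V₁)) (σ₂ : GLm m →ₗ[ℝ] (V₂ →L[ℝ] V₂))

/-- The representation `σ^{(k)}` of `gl(m,ℝ)` on `S^k ℝ^m ⊗ Hom(V₁,V₂)`, determined by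
`σ^{(k)}(B)(h₁∨⋯∨h_k ⊗ A) = Σᵢ h₁∨⋯∨(B hᵢ)∨⋯∨h_k ⊗ A + h₁∨⋯∨h_k ⊗ (σ₂(B)∘A - A∘σ₁(B))`. -/
def sigmaS {k : ℕ} (B : GLm m) (T : Symb m V₁ V₂ k) : Symb m V₁ V₂ k :=
  (∑ t : Fin k, T.compContinuousLinearMap
    (fun s => if s = t then (ContinuousLinearMap.compL ℝ (Rm m) (Rm m) ℝ).flip B
      else ContinuousLinearMap.id ℝ (Dualm m)))
  + ((ContinuousLinearMap.compL ℝ V₁ V₂ V₂ (σ₂ B))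
      - (ContinuousLinearMap.compL ℝ V₁ V₁ V₂).flip (σ₁ B)).compContinuousMultilinearMap T

/-- The `i`-th coordinate covector on `ℝ^m`. -/
def coordD (i : Fin m) : Dualm m := ContinuousLinearMap.proj i

/-- The affine quantization (standard ordering): the full contraction of a degree-`k` symbol
with the `k`-th derivative, `Q_Aff(h₁∨⋯∨h_k ⊗ A)(f) = A(∂_{h₁} ⋯ ∂_{h_k} f)`. -/
def QAff {k : ℕ} (T : Rm m → Symb m V₁ V₂ k) (f : Rm m → V₁) : Rm m → V₂ :=
  fun x => (k.factorial : ℝ)⁻¹ • ∑ d : Fin k → Fin m,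
    (T x (fun t => coordD m (d t))) (iteratedFDeriv ℝ k f x (fun t => Pi.single (d t) 1))

/-- The defining property of the map `γ(h) : S^{k+1} ℝ^m ⊗ Hom(V₁,V₂) → S^k ℝ^m ⊗ Hom(V₁,V₂)`,
for `h ∈ ℝ^{m*} ≅ 𝔤₁`:
`γ(h)(h₁∨⋯∨h_{k+1} ⊗ A) = Σᵢ h₁∨⋯(omit hᵢ)⋯∨h_{k+1} ⊗ (A ∘ σ₁(hᵢ⊗h + h(hᵢ)·Id))`
`- Σᵢ Σ_{j<i} h₁∨⋯(omit hⱼ,hᵢ)⋯∨h_{k+1} ∨ (h(hⱼ)·hᵢ + h(hᵢ)·hⱼ) ⊗ A`. -/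
def gammaProp {k : ℕ}
    (γ : Dualm m → (Symb m V₁ V₂ (k+1) →ₗ[ℝ] Symb m V₁ V₂ k)) : Prop :=
  ∀ (h : Dualm m) (v : Fin (k+1) → Rm m) (A : V₁ →L[ℝ] V₂),
    γ h (symT m V₁ V₂ v A) =
      (∑ i : Fin (k+1), symT m V₁ V₂ (i.removeNth v)
        (A.comp (σ₁ (rkOne m (v i) h + h (v i) • ContinuousLinearMap.id ℝ (Rm m)))))
      - ∑ i : Fin (k+1), ∑ j : Fin k,
          if (i.succAbove j : ℕ) < (i : ℕ) then
            symT m V₁ V₂ (i.removeNth (Function.update v (i.succAbove j)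
              (h (v (i.succAbove j)) • v i + h (v i) • v (i.succAbove j)))) A
          else 0

/-- The model for `⊕_{k=0}^K S^k ℝ^m ⊗ Hom(V₁,V₂)`. -/
abbrev SymbT (K : ℕ) := ∀ k : Fin (K+1), Symb m V₁ V₂ (k : ℕ)

/-- The degree-wise representation `⊕_k σ^{(k)}` on `⊕_{k=0}^K S^k ℝ^m ⊗ Hom(V₁,V₂)`. -/
def sigmaT {K : ℕ} (B : GLm m) (T : SymbT m V₁ V₂ K) : SymbT m V₁ V₂ K :=
  fun k => sigmaS m V₁ V₂ σ₁ σ₂ B (T k)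

/-- The extension of a family `γ` to `⊕_{k=0}^K S^k ℝ^m ⊗ Hom(V₁,V₂)` (lowering degree). -/
def gTot {K : ℕ} (γf : ∀ k : ℕ, Dualm m → (Symb m V₁ V₂ (k+1) →ₗ[ℝ] Symb m V₁ V₂ k))
    (h : Dualm m) (T : SymbT m V₁ V₂ K) : SymbT m V₁ V₂ K :=
  fun k => if hk : (k : ℕ) + 1 < K + 1 then γf (k : ℕ) h (T ⟨(k : ℕ) + 1, hk⟩) else 0


/-- The action `ρ^{(k)}(a) = S^k a ⊗ (Φ ↦ ρ₂(a)∘Φ∘ρ₁(a)⁻¹)` of `GL(m,ℝ)` on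
`S^k ℝ^m ⊗ Hom(V₁,V₂)`, in the model. -/
def rhoK {k : ℕ} (a : (Fin m → ℝ) ≃L[ℝ] (Fin m → ℝ)) (r₁ : V₁ ≃L[ℝ] V₁) (r₂ : V₂ ≃L[ℝ] V₂)
    (T : Symb m V₁ V₂ k) : Symb m V₁ V₂ k :=
  ((ContinuousLinearMap.compL ℝ V₁ V₂ V₂ (r₂ : V₂ →L[ℝ] V₂)) ∘L
    ((ContinuousLinearMap.compL ℝ V₁ V₁ V₂).flip
      ((r₁.symm : V₁ →L[ℝ] V₁)))).compContinuousMultilinearMap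
    (T.compContinuousLinearMap
      (fun _ => (ContinuousLinearMap.compL ℝ (Rm m) (Rm m) ℝ).flip
        (a : (Fin m → ℝ) →L[ℝ] (Fin m → ℝ))))

end Symbols

section Matrices

variable (m : ℕ)

/-- The element of `𝔤₁ ⊂ sl(m+1,ℝ)` with `ξ`-block the covector `h`. -/
def hMat (h : Dualm m) : Matrix (Idx m) (Idx m) ℝ :=
  Matrix.fromBlocks 0 0 (Matrix.of fun _ j => h (Pi.single j 1)) 0

/-- The element of `𝔤₋₁ ⊂ sl(m+1,ℝ)` with `v`-block the vector `X`. -/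
def XMat (X : Rm m) : Matrix (Idx m) (Idx m) ℝ :=
  Matrix.fromBlocks 0 (Matrix.of fun i _ => X i) 0 0

/-- The lift `B̃ ∈ 𝔤₀ ⊂ sl(m+1,ℝ)` of `B ∈ gl(m,ℝ)`, with `ψ(B̃) = B`. -/
def BTilde (B : GLm m) : Matrix (Idx m) (Idx m) ℝ :=
  Matrix.fromBlocks
    (LinearMap.toMatrix' (B : (Fin m → ℝ) →ₗ[ℝ] (Fin m → ℝ))
      - ((LinearMap.trace ℝ (Rm m) (B : (Fin m → ℝ) →ₗ[ℝ] (Fin m → ℝ))) / ((m : ℝ) + 1)) • 1)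
    0 0
    (Matrix.of fun _ _ => -(LinearMap.trace ℝ (Rm m) (B : (Fin m → ℝ) →ₗ[ℝ] (Fin m → ℝ))) / ((m : ℝ) + 1))

/-- The map `ψ : 𝔤₀ → gl(m,ℝ) : [[A,0],[0,a]] ↦ A - a·Id`. -/
def psiC (M : Matrix (Idx m) (Idx m) ℝ) : GLm m :=
  LinearMap.toContinuousLinearMap
    ((Matrix.of fun i j => M (Sum.inl i) (Sum.inl j)).mulVecLin
      - M (Sum.inr ()) (Sum.inr ()) • LinearMap.id)

/-- The basis `(eᵢ)` of `𝔤₋₁`, corresponding to the standard basis of `ℝ^m`. -/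
def eMat (i : Fin m) : Matrix (Idx m) (Idx m) ℝ := XMat m (Pi.single i 1)

/-- The covector `εⁱ = (1/(2(m+1))) δⁱ ∈ ℝ^{m*}`. -/
def epsD (i : Fin m) : Dualm m := (1 / (2 * ((m : ℝ) + 1))) • coordD m i

/-- The basis `(εⁱ)` of `𝔤₁`, Killing-dual to `(eᵢ)`. -/
def epsMat (i : Fin m) : Matrix (Idx m) (Idx m) ℝ := hMat m (epsD m i)

/-- The Euler element `E = diag(-1/(m+1), …, -1/(m+1), m/(m+1)) ∈ 𝔤₀`, with `ψ(E) = -Id`. -/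
def EMat : Matrix (Idx m) (Idx m) ℝ :=
  Matrix.fromBlocks ((-(1 / ((m : ℝ) + 1))) • 1) 0 0 (Matrix.of fun _ _ => (m : ℝ) / ((m : ℝ) + 1))

/-- Membership in `𝔰 ≅ sl(m,ℝ) ⊂ 𝔤₀`: block diagonal with vanishing corner and traceless. -/
def inS (M : Matrix (Idx m) (Idx m) ℝ) : Prop :=
  (∀ i, M (Sum.inl i) (Sum.inr ()) = 0) ∧ (∀ j, M (Sum.inr ()) (Sum.inl j) = 0) ∧
    M (Sum.inr ()) (Sum.inr ()) = 0 ∧ Matrix.trace M = 0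

/-- Membership in `𝔤₋₁`: only the `v`-block is nonzero. -/
def inGm1 (M : Matrix (Idx m) (Idx m) ℝ) : Prop :=
  (∀ i j, M (Sum.inl i) (Sum.inl j) = 0) ∧ (∀ j, M (Sum.inr ()) (Sum.inl j) = 0) ∧
    M (Sum.inr ()) (Sum.inr ()) = 0

/-- Membership in `𝔤₁`: only the `ξ`-block is nonzero. -/
def inG1 (M : Matrix (Idx m) (Idx m) ℝ) : Prop :=
  (∀ i j, M (Sum.inl i) (Sum.inl j) = 0) ∧ (∀ i, M (Sum.inl i) (Sum.inr ()) = 0) ∧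
    M (Sum.inr ()) (Sum.inr ()) = 0

/-- Membership in `𝔤₀`: block diagonal. -/
def inG0 (M : Matrix (Idx m) (Idx m) ℝ) : Prop :=
  (∀ i, M (Sum.inl i) (Sum.inr ()) = 0) ∧ (∀ j, M (Sum.inr ()) (Sum.inl j) = 0)

/-- The Killing form of `sl(m+1,ℝ)`: `κ(M,N) = 2(m+1) tr(MN)`. -/
def kappa (M N : Matrix (Idx m) (Idx m) ℝ) : ℝ := 2 * ((m : ℝ) + 1) * Matrix.trace (M * N)

end Matrices

section SymbolOperators

variable (m : ℕ) (V₁ V₂ : Type)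
  [NormedAddCommGroup V₁] [NormedSpace ℝ V₁] [NormedAddCommGroup V₂] [NormedSpace ℝ V₂]
  (σ₁ : GLm m →ₗ[ℝ] (V₁ →L[ℝ] V₁)) (σ₂ : GLm m →ₗ[ℝ] (V₂ →L[ℝ] V₂))

/-- The operator `C₀ = (1/2)σ^{(k)}(Id) + (1/2m)σ^{(k)}(Id)² + Σ_s σ^{(k)}(ψ(h_s))∘σ^{(k)}(ψ(h_s^*))`
on `S^k ℝ^m ⊗ Hom(V₁,V₂)`. -/
def C0op {k : ℕ} {n : ℕ} (hs hs' : Fin n → Matrix (Idx m) (Idx m) ℝ)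
    (T : Symb m V₁ V₂ k) : Symb m V₁ V₂ k :=
  (1/2 : ℝ) • sigmaS m V₁ V₂ σ₁ σ₂ (ContinuousLinearMap.id ℝ (Rm m)) T
  + (1/(2*(m : ℝ))) • sigmaS m V₁ V₂ σ₁ σ₂ (ContinuousLinearMap.id ℝ (Rm m))
      (sigmaS m V₁ V₂ σ₁ σ₂ (ContinuousLinearMap.id ℝ (Rm m)) T)
  + ∑ s, sigmaS m V₁ V₂ σ₁ σ₂ (psiC m (hs s)) (sigmaS m V₁ V₂ σ₁ σ₂ (psiC m (hs' s)) T)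

/-- `C₀` acting degreewise on `⊕_{k=0}^K S^k ℝ^m ⊗ Hom(V₁,V₂)`. -/
def C0tot {K : ℕ} {n : ℕ} (hs hs' : Fin n → Matrix (Idx m) (Idx m) ℝ)
    (T : SymbT m V₁ V₂ K) : SymbT m V₁ V₂ K :=
  fun k => C0op m V₁ V₂ σ₁ σ₂ hs hs' (T k)

/-- The operator `𝓛_M = L_{X^M} + γ(ξ_M)` (flat curly Lie derivative) on functions with values
in `⊕_{k=0}^K S^k ℝ^m ⊗ Hom(V₁,V₂)`, where `ξ_M` is the `𝔤₁`-component of `M`. -/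
def curlyL {K : ℕ} (γf : ∀ k : ℕ, Dualm m → (Symb m V₁ V₂ (k+1) →ₗ[ℝ] Symb m V₁ V₂ k))
    (M : Matrix (Idx m) (Idx m) ℝ) (f : Rm m → SymbT m V₁ V₂ K) : Rm m → SymbT m V₁ V₂ K :=
  fun x => lieD m (fun B T => sigmaT m V₁ V₂ σ₁ σ₂ B T) (projVF m M) f x
    + gTot m V₁ V₂ γf (∑ j, M (Sum.inr ()) (Sum.inl j) • coordD m j) (f x)

end SymbolOperators

section Curved

variable (m : ℕ) (P : Type) [NormedAddCommGroup P] [NormedSpace ℝ P]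

/-- The invariant derivative `L_{ω^{-1}(Z)} f` along the `ω`-constant vector field `η Z`. -/
def LD (η : Matrix (Idx m) (Idx m) ℝ → P → P) (Z : Matrix (Idx m) (Idx m) ℝ)
    {V : Type} [NormedAddCommGroup V] [NormedSpace ℝ V] (f : P → V) : P → V :=
  fun u => fderiv ℝ f u (η Z u)

/-- The bracket compatibility satisfied by a normal Cartan connection: for `M ∈ 𝔤₀ ⊕ 𝔤₁` and
`N ∈ 𝔤₋₁`, `L_{ω^{-1}(M)} ∘ L_{ω^{-1}(N)} - L_{ω^{-1}(N)} ∘ L_{ω^{-1}(M)} = L_{ω^{-1}([M,N])}` on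
smooth vector-space-valued functions. -/
def BracketCompat (η : Matrix (Idx m) (Idx m) ℝ → P → P) : Prop :=
  ∀ (V : Type) [NormedAddCommGroup V] [NormedSpace ℝ V],
    ∀ f : P → V, ContDiff ℝ (⊤ : ℕ∞) f →
      ∀ M N : Matrix (Idx m) (Idx m) ℝ, Matrix.trace M = 0 → Matrix.trace N = 0 →
        (∀ i, M (Sum.inl i) (Sum.inr ()) = 0) → inGm1 m N →
        (LD m P η M (LD m P η N f) - LD m P η N (LD m P η M f)) = LD m P η (M * N - N * M) f

/-- Infinitesimal `G₀`-equivariance of `f : P → V` with respect to `σ`: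
`L_{ω^{-1}(B̃)} f = -σ(B) f` for all `B ∈ gl(m,ℝ)`. -/
def equivG0 (η : Matrix (Idx m) (Idx m) ℝ → P → P)
    {V : Type} [NormedAddCommGroup V] [NormedSpace ℝ V]
    (σ : GLm m → V → V) (f : P → V) : Prop :=
  ∀ B : GLm m, LD m P η (BTilde m B) f = fun u => -(σ B (f u))

/-- Iterated invariant derivatives along `𝔤₋₁`-constant fields. -/
def iterL (η : Matrix (Idx m) (Idx m) ℝ → P → P)
    {V : Type} [NormedAddCommGroup V] [NormedSpace ℝ V] :
    (k : ℕ) → (Fin k → Rm m) → (P → V) → (P → V)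
  | 0, _, f => f
  | (k+1), v, f => LD m P η (XMat m (v 0)) (iterL η k (fun j => v j.succ) f)

/-- The symmetrized iterated invariant differential `(∇^ω)^k f`, evaluated on
`(X₁, …, X_k) ∈ (ℝ^m)^k`. -/
def nabK (η : Matrix (Idx m) (Idx m) ℝ → P → P)
    {V : Type} [NormedAddCommGroup V] [NormedSpace ℝ V]
    (k : ℕ) (f : P → V) (v : Fin k → Rm m) : P → V :=
  fun u => (k.factorial : ℝ)⁻¹ • ∑ ν : Equiv.Perm (Fin k), iterL m P η k (v ∘ ν) f u

variable (V₁ V₂ : Type)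
  [NormedAddCommGroup V₁] [NormedSpace ℝ V₁] [NormedAddCommGroup V₂] [NormedSpace ℝ V₂]

/-- The curved quantization map: `Q_ω(T)(f)(u) = ⟨T(u), (∇^ω)^k f(u)⟩` (full contraction). -/
def Qom (η : Matrix (Idx m) (Idx m) ℝ → P → P) {k : ℕ}
    (T : P → Symb m V₁ V₂ k) (f : P → V₁) : P → V₂ :=
  fun u => (k.factorial : ℝ)⁻¹ • ∑ d : Fin k → Fin m,
    (T u (fun t => coordD m (d t))) (nabK m P η k f (fun t => Pi.single (d t) 1) u)


/-- The curved operator `N^ω f = -2 Σᵢ γ(εⁱ)(L_{ω^{-1}(eᵢ)} f)`. -/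
def Nom {K : ℕ} (γf : ∀ k : ℕ, Dualm m → (Symb m V₁ V₂ (k+1) →ₗ[ℝ] Symb m V₁ V₂ k))
    (η : Matrix (Idx m) (Idx m) ℝ → P → P) (f : P → SymbT m V₁ V₂ K) : P → SymbT m V₁ V₂ K :=
  fun u => (-2 : ℝ) • ∑ i : Fin m, gTot m V₁ V₂ γf (epsD m i)
    (LD m P η (XMat m (Pi.single i 1)) f u)

end Curved

section SymbolLemmas

variable {m : ℕ} {V₁ V₂ : Type}
  [NormedAddCommGroup V₁] [NormedSpace ℝ V₁] [NormedAddCommGroup V₂] [NormedSpace ℝ V₂]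

instance finiteDimensional_symb [FiniteDimensional ℝ V₁] [FiniteDimensional ℝ V₂] (k : ℕ) :
    FiniteDimensional ℝ (Symb m V₁ V₂ k) :=
  FiniteDimensional.of_injective
    (ContinuousMultilinearMap.toMultilinearMapLinear :
      Symb m V₁ V₂ k →ₗ[ℝ] MultilinearMap ℝ (fun _ : Fin k => Dualm m) (V₁ →L[ℝ] V₂))
    ContinuousMultilinearMap.toMultilinearMap_injective

lemma pureT_apply {k : ℕ} (v : Fin k → Rm m) (A : V₁ →L[ℝ] V₂) (φ : Fin k → Dualm m) :
    pureT m V₁ V₂ v A φ = (∏ i, φ i (v i)) • A := by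
  simp [pureT]

lemma symT_apply {k : ℕ} (v : Fin k → Rm m) (A : V₁ →L[ℝ] V₂) (φ : Fin k → Dualm m) :
    symT m V₁ V₂ v A φ = ∑ ν : Equiv.Perm (Fin k), (∏ i, φ i (v (ν i))) • A := by
  simp [symT, pureT_apply]

/-- Evaluation of the symmetric product at covectors, as a multilinear map in the vectors. -/
def symTEval {k : ℕ} (A : V₁ →L[ℝ] V₂) (φ : Fin k → Dualm m) :
    MultilinearMap ℝ (fun _ : Fin k => Rm m) (V₁ →L[ℝ] V₂) :=
  ∑ ν : Equiv.Perm (Fin k), (MultilinearMap.mkPiRing ℝ (Fin k) A).compLinearMap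
    (fun i => (φ (ν.symm i) : Rm m →ₗ[ℝ] ℝ))

lemma symT_apply_eq_symTEval {k : ℕ} (v : Fin k → Rm m) (A : V₁ →L[ℝ] V₂)
    (φ : Fin k → Dualm m) : symT m V₁ V₂ v A φ = symTEval A φ v := by
  rw [symT_apply, symTEval, sum_apply]
  refine Finset.sum_congr rfl fun ν _ => ?_
  rw [MultilinearMap.compLinearMap_apply, MultilinearMap.mkPiRing_apply]
  congr 1
  conv_rhs => rw [← Equiv.prod_comp ν]
  simp

lemma symT_update_add {k : ℕ} (v : Fin k → Rm m) (j : Fin k) (x y : Rm m) (A : V₁ →L[ℝ] V₂) :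
    symT m V₁ V₂ (Function.update v j (x + y)) A
      = symT m V₁ V₂ (Function.update v j x) A + symT m V₁ V₂ (Function.update v j y) A := by
  ext1 φ
  simp only [add_apply, symT_apply_eq_symTEval,
    MultilinearMap.map_update_add]

lemma symT_update_smul {k : ℕ} (v : Fin k → Rm m) (j : Fin k) (c : ℝ) (x : Rm m)
    (A : V₁ →L[ℝ] V₂) :
    symT m V₁ V₂ (Function.update v j (c • x)) A
      = c • symT m V₁ V₂ (Function.update v j x) A := by
  ext1 φ
  simp only [smul_apply, symT_apply_eq_symTEval,
    MultilinearMap.map_update_smul]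

lemma symT_add {k : ℕ} (v : Fin k → Rm m) (A A' : V₁ →L[ℝ] V₂) :
    symT m V₁ V₂ v (A + A') = symT m V₁ V₂ v A + symT m V₁ V₂ v A' := by
  ext1 φ
  simp only [add_apply, symT_apply, smul_add, Finset.sum_add_distrib]

lemma symT_smul {k : ℕ} (v : Fin k → Rm m) (c : ℝ) (A : V₁ →L[ℝ] V₂) :
    symT m V₁ V₂ v (c • A) = c • symT m V₁ V₂ v A := by
  ext1 φ
  simp only [smul_apply, symT_apply, Finset.smul_sum]
  exact Finset.sum_congr rfl fun ν _ => smul_comm _ _ _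

variable (σ₁ : GLm m →ₗ[ℝ] (V₁ →L[ℝ] V₁)) (σ₂ : GLm m →ₗ[ℝ] (V₂ →L[ℝ] V₂))

lemma sigmaS_apply {k : ℕ} (B : GLm m) (T : Symb m V₁ V₂ k) (φ : Fin k → Dualm m) :
    sigmaS m V₁ V₂ σ₁ σ₂ B T φ
      = ∑ t, T (Function.update φ t ((φ t).comp B))
        + ((σ₂ B).comp (T φ) - (T φ).comp (σ₁ B)) := by
  simp only [sigmaS, add_apply, sum_apply,
    ContinuousMultilinearMap.compContinuousLinearMap_apply,
    ContinuousLinearMap.compContinuousMultilinearMap_coe, Function.comp_apply,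
    sub_apply, ContinuousLinearMap.compL_apply,
    ContinuousLinearMap.flip_apply]
  congr 1
  refine Finset.sum_congr rfl fun t _ => ?_
  congr 1
  ext1 s
  by_cases hs : s = t
  · subst hs; simp
  · simp [hs]

/-- The operator `σ^{(k)}(B)` as a linear map. -/
def sigmaSLin {k : ℕ} (B : GLm m) : Symb m V₁ V₂ k →ₗ[ℝ] Symb m V₁ V₂ k where
  toFun := sigmaS m V₁ V₂ σ₁ σ₂ B
  map_add' S T := by
    ext1 φ
    simp only [add_apply, sigmaS_apply, Finset.sum_add_distrib,
      ContinuousLinearMap.comp_add, ContinuousLinearMap.add_comp]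
    abel
  map_smul' c T := by
    ext1 φ
    simp only [smul_apply, sigmaS_apply, Finset.smul_sum, smul_add,
      smul_sub, ContinuousLinearMap.comp_smul, ContinuousLinearMap.smul_comp, RingHom.id_apply]

lemma sigmaS_symT {k : ℕ} (B : GLm m) (v : Fin k → Rm m) (A : V₁ →L[ℝ] V₂) :
    sigmaS m V₁ V₂ σ₁ σ₂ B (symT m V₁ V₂ v A)
      = ∑ t, symT m V₁ V₂ (Function.update v t (B (v t))) A
        + symT m V₁ V₂ v ((σ₂ B).comp A - A.comp (σ₁ B)) := by
  ext1 φ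
  rw [sigmaS_apply]
  simp only [add_apply, sum_apply, symT_apply]
  congr 1
  · rw [Finset.sum_comm]
    conv_rhs => rw [Finset.sum_comm]
    refine Finset.sum_congr rfl fun ν _ => ?_
    conv_rhs => rw [← Equiv.sum_comp ν]
    refine Finset.sum_congr rfl fun t _ => ?_
    congr 1
    refine Finset.prod_congr rfl fun s _ => ?_
    by_cases hs : s = t
    · subst hs; simp
    · simp [hs]
  · simp only [ContinuousLinearMap.comp_finsetSum, ContinuousLinearMap.finsetSum_comp,
      ContinuousLinearMap.comp_smul, ContinuousLinearMap.smul_comp, smul_sub,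
      Finset.sum_sub_distrib]

variable {σ₁}

/-- The term of `γ(h)` in which `hᵢ` is omitted and contracted through `σ₁`. -/
def gammaOne (σ₁ : GLm m →ₗ[ℝ] (V₁ →L[ℝ] V₁)) {k : ℕ} (h : Dualm m) (v : Fin (k+1) → Rm m)
    (A : V₁ →L[ℝ] V₂) (i : Fin (k+1)) : Symb m V₁ V₂ k :=
  symT m V₁ V₂ (i.removeNth v)
    (A.comp (σ₁ (rkOne m (v i) h + h (v i) • ContinuousLinearMap.id ℝ (Rm m))))

/-- The term of `γ(h)` in which a pair of vectors is contracted. -/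
def gammaTwo {k : ℕ} (h : Dualm m) (v : Fin (k+1) → Rm m)
    (A : V₁ →L[ℝ] V₂) (i : Fin (k+1)) (j : Fin k) : Symb m V₁ V₂ k :=
  symT m V₁ V₂ (Function.update (i.removeNth v) j
    (h (v (i.succAbove j)) • v i + h (v i) • v (i.succAbove j))) A

lemma gamma_symT {k : ℕ} {γ : Dualm m → (Symb m V₁ V₂ (k+1) →ₗ[ℝ] Symb m V₁ V₂ k)}
    (hγ : gammaProp m V₁ V₂ σ₁ γ) (h : Dualm m) (v : Fin (k+1) → Rm m) (A : V₁ →L[ℝ] V₂) :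
    γ h (symT m V₁ V₂ v A) = ∑ i, gammaOne σ₁ h v A i
      - ∑ i : Fin (k+1), ∑ j : Fin k,
          if (i.succAbove j : ℕ) < (i : ℕ) then gammaTwo h v A i j else 0 := by
  rw [hγ]
  simp only [gammaOne, gammaTwo, Fin.removeNth_update_succAbove]

lemma rkOne_add (u : Rm m) (h h' : Dualm m) :
    rkOne m u (h + h') = rkOne m u h + rkOne m u h' := by
  ext x : 1
  simp [rkOne, add_smul]

lemma rkOne_smul (u : Rm m) (c : ℝ) (h : Dualm m) :
    rkOne m u (c • h) = c • rkOne m u h := by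
  ext x : 1
  simp [rkOne, smul_smul]

lemma gammaOne_add {k : ℕ} (h h' : Dualm m) (v : Fin (k+1) → Rm m) (A : V₁ →L[ℝ] V₂)
    (i : Fin (k+1)) :
    gammaOne σ₁ (h + h') v A i = gammaOne σ₁ h v A i + gammaOne σ₁ h' v A i := by
  simp only [gammaOne, ← symT_add, ← ContinuousLinearMap.comp_add, ← map_add, rkOne_add,
    add_apply, add_smul]
  congr 3
  abel

lemma gammaOne_smul {k : ℕ} (c : ℝ) (h : Dualm m) (v : Fin (k+1) → Rm m) (A : V₁ →L[ℝ] V₂)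
    (i : Fin (k+1)) : gammaOne σ₁ (c • h) v A i = c • gammaOne σ₁ h v A i := by
  simp only [gammaOne, ← symT_smul, ← ContinuousLinearMap.comp_smul, ← map_smul, rkOne_smul,
    smul_apply, smul_add, smul_smul, smul_eq_mul]

lemma gammaTwo_add {k : ℕ} (h h' : Dualm m) (v : Fin (k+1) → Rm m) (A : V₁ →L[ℝ] V₂)
    (i : Fin (k+1)) (j : Fin k) :
    gammaTwo (h + h') v A i j = gammaTwo h v A i j + gammaTwo h' v A i j := by
  simp only [gammaTwo, symT_update_add, symT_update_smul, add_apply, add_smul]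
  abel

lemma gammaTwo_smul {k : ℕ} (c : ℝ) (h : Dualm m) (v : Fin (k+1) → Rm m) (A : V₁ →L[ℝ] V₂)
    (i : Fin (k+1)) (j : Fin k) : gammaTwo (c • h) v A i j = c • gammaTwo h v A i j := by
  simp only [gammaTwo, symT_update_add, symT_update_smul, smul_apply,
    smul_add, smul_smul, smul_eq_mul]

lemma gamma_add {k : ℕ} {γ : Dualm m → (Symb m V₁ V₂ (k+1) →ₗ[ℝ] Symb m V₁ V₂ k)}
    (hγ : gammaProp m V₁ V₂ σ₁ γ) (h h' : Dualm m) {T : Symb m V₁ V₂ (k+1)}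
    (hT : T ∈ spanGen m V₁ V₂ (k+1)) : γ (h + h') T = γ h T + γ h' T := by
  refine LinearMap.eqOn_span (f := γ (h + h')) (g := γ h + γ h') ?_ hT
  rintro _ ⟨v, A, rfl⟩
  simp only [LinearMap.add_apply, gamma_symT hγ, gammaOne_add, gammaTwo_add, ite_add_zero,
    Finset.sum_add_distrib]
  abel

lemma gamma_smul {k : ℕ} {γ : Dualm m → (Symb m V₁ V₂ (k+1) →ₗ[ℝ] Symb m V₁ V₂ k)}
    (hγ : gammaProp m V₁ V₂ σ₁ γ) (c : ℝ) (h : Dualm m) {T : Symb m V₁ V₂ (k+1)}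
    (hT : T ∈ spanGen m V₁ V₂ (k+1)) : γ (c • h) T = c • γ h T := by
  refine LinearMap.eqOn_span (f := γ (c • h)) (g := c • γ h) ?_ hT
  rintro _ ⟨v, A, rfl⟩
  simp only [LinearMap.smul_apply, gamma_symT hγ, gammaOne_smul, gammaTwo_smul]
  rw [smul_sub (A := Symb m V₁ V₂ k)]
  simp only [Finset.smul_sum, smul_ite, smul_zero (A := Symb m V₁ V₂ k)]

lemma gammaOne_equivariant (hσ₁ : IsLieRep m σ₁) {k : ℕ} (B : GLm m) (h : Dualm m)
    (v : Fin (k+1) → Rm m) (A : V₁ →L[ℝ] V₂) (i : Fin (k+1)) :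
    ∑ t, gammaOne σ₁ h (Function.update v t (B (v t))) A i
        + gammaOne σ₁ h v ((σ₂ B).comp A - A.comp (σ₁ B)) i
      = sigmaS m V₁ V₂ σ₁ σ₂ B (gammaOne σ₁ h v A i) + gammaOne σ₁ (h.comp B) v A i := by
  rw [Fin.sum_univ_succAbove _ i]
  simp only [gammaOne, sigmaS_symT, Fin.removeNth_update_succAbove, Fin.removeNth_update,
    Function.update_self, Function.update_of_ne (Fin.ne_succAbove i _)]
  have key : A.comp (σ₁ (rkOne m (B (v i)) h + h (B (v i)) • ContinuousLinearMap.id ℝ (Rm m)))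
      + ((σ₂ B).comp A - A.comp (σ₁ B)).comp
          (σ₁ (rkOne m (v i) h + h (v i) • ContinuousLinearMap.id ℝ (Rm m)))
      = ((σ₂ B).comp (A.comp
            (σ₁ (rkOne m (v i) h + h (v i) • ContinuousLinearMap.id ℝ (Rm m))))
          - (A.comp (σ₁ (rkOne m (v i) h + h (v i) • ContinuousLinearMap.id ℝ (Rm m)))).comp
            (σ₁ B))
        + A.comp (σ₁ (rkOne m (v i) (h.comp B)
            + (h.comp B) (v i) • ContinuousLinearMap.id ℝ (Rm m))) := by
    have hR := hσ₁ (rkOne m (v i) h + h (v i) • ContinuousLinearMap.id ℝ (Rm m)) B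
    have hE : rkOne m (v i) (h.comp B) + (h.comp B) (v i) • ContinuousLinearMap.id ℝ (Rm m)
        = (rkOne m (B (v i)) h + h (B (v i)) • ContinuousLinearMap.id ℝ (Rm m))
        + ((rkOne m (v i) h + h (v i) • ContinuousLinearMap.id ℝ (Rm m)).comp B
          - B.comp (rkOne m (v i) h + h (v i) • ContinuousLinearMap.id ℝ (Rm m))) := by
      ext x : 1
      simp [rkOne]
      abel
    rw [hE, map_add σ₁ (rkOne m (B (v i)) h + _), hR]
    simp only [ContinuousLinearMap.comp_add, ContinuousLinearMap.comp_sub,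
      ContinuousLinearMap.sub_comp, ContinuousLinearMap.comp_assoc]
    abel
  have key' := congrArg (symT m V₁ V₂ (i.removeNth v)) key
  simp only [symT_add] at key'
  rw [add_right_comm, key']
  simp only [Fin.removeNth]
  abel

lemma gammaTwo_equivariant {k : ℕ} (B : GLm m) (h : Dualm m)
    (v : Fin (k+1) → Rm m) (A : V₁ →L[ℝ] V₂) (i : Fin (k+1)) (j : Fin k) :
    ∑ t, gammaTwo h (Function.update v t (B (v t))) A i j
        + gammaTwo h v ((σ₂ B).comp A - A.comp (σ₁ B)) i j
      = sigmaS m V₁ V₂ σ₁ σ₂ B (gammaTwo h v A i j) + gammaTwo (h.comp B) v A i j := by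
  rw [Fin.sum_univ_succAbove _ i]
  simp only [gammaTwo, sigmaS_symT]
  rw [add_right_comm _ _ (symT m V₁ V₂ _ A)]
  congr 1
  conv_lhs => rw [← Finset.add_sum_erase _ _ (Finset.mem_univ j)]
  conv_rhs => rw [← Finset.add_sum_erase _ _ (Finset.mem_univ j)]
  have hne : ∀ s ∈ Finset.univ.erase j,
      symT m V₁ V₂ (Function.update (i.removeNth (Function.update v (i.succAbove s)
          (B (v (i.succAbove s))))) j
        (h (Function.update v (i.succAbove s) (B (v (i.succAbove s))) (i.succAbove j)) •
            Function.update v (i.succAbove s) (B (v (i.succAbove s))) i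
          + h (Function.update v (i.succAbove s) (B (v (i.succAbove s))) i) •
            Function.update v (i.succAbove s) (B (v (i.succAbove s))) (i.succAbove j))) A
      = symT m V₁ V₂ (Function.update (Function.update (i.removeNth v) j
          (h (v (i.succAbove j)) • v i + h (v i) • v (i.succAbove j))) s
          (B (Function.update (i.removeNth v) j
          (h (v (i.succAbove j)) • v i + h (v i) • v (i.succAbove j)) s))) A := by
    intro s hs
    have hsj : s ≠ j := Finset.ne_of_mem_erase hs
    have h1 : i.succAbove j ≠ i.succAbove s := fun e => hsj (Fin.succAbove_right_injective e).symm
    rw [Function.update_of_ne h1, Function.update_of_ne (Fin.ne_succAbove i s),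
      Function.update_of_ne hsj, Fin.removeNth_update_succAbove, Function.update_comm hsj]
    rfl
  rw [Finset.sum_congr rfl hne]
  simp only [Fin.removeNth_update_succAbove, Fin.removeNth_update, Function.update_self,
    Function.update_of_ne (Fin.ne_succAbove i _), Function.update_of_ne (Fin.succAbove_ne i _),
    Function.update_idem, map_add, map_smul, symT_update_add, symT_update_smul,
    ContinuousLinearMap.comp_apply]
  abel

lemma gamma_equivariant (hσ₁ : IsLieRep m σ₁) {k : ℕ}
    {γ : Dualm m → (Symb m V₁ V₂ (k+1) →ₗ[ℝ] Symb m V₁ V₂ k)}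
    (hγ : gammaProp m V₁ V₂ σ₁ γ) (B : GLm m) (h : Dualm m) {T : Symb m V₁ V₂ (k+1)}
    (hT : T ∈ spanGen m V₁ V₂ (k+1)) :
    γ h (sigmaS m V₁ V₂ σ₁ σ₂ B T)
      = sigmaS m V₁ V₂ σ₁ σ₂ B (γ h T) + γ (h.comp B) T := by
  refine LinearMap.eqOn_span (f := γ h ∘ₗ sigmaSLin σ₁ σ₂ B)
    (g := sigmaSLin σ₁ σ₂ B ∘ₗ γ h + γ (h.comp B)) ?_ hT
  rintro _ ⟨v, A, rfl⟩
  have h0 : (sigmaSLin σ₁ σ₂ B) (symT m V₁ V₂ v A)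
      = sigmaS m V₁ V₂ σ₁ σ₂ B (symT m V₁ V₂ v A) := rfl
  simp only [LinearMap.add_apply, LinearMap.comp_apply, h0]
  rw [sigmaS_symT, map_add, map_sum]
  have hs : ∀ S T : Symb m V₁ V₂ k, sigmaSLin σ₁ σ₂ B (S - T)
      = sigmaSLin σ₁ σ₂ B S - sigmaSLin σ₁ σ₂ B T :=
    LinearMap.map_sub (M := Symb m V₁ V₂ k) (M₂ := Symb m V₁ V₂ k) (sigmaSLin σ₁ σ₂ B)
  simp only [gamma_symT hγ, map_sum, hs, apply_ite (sigmaSLin σ₁ σ₂ B), map_zero, Finset.sum_sub_distrib (G := Symb m V₁ V₂ k)]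
  have e1 := Finset.sum_congr rfl fun (i : Fin (k+1)) (_ : i ∈ Finset.univ) =>
    gammaOne_equivariant σ₂ hσ₁ B h v A i
  have e2 := Finset.sum_congr rfl fun (i : Fin (k+1)) (_ : i ∈ Finset.univ) => Finset.sum_congr rfl
    fun (j : Fin k) (_ : j ∈ Finset.univ) => congrArg (fun S => if (i.succAbove j : ℕ) < (i : ℕ) then S else 0)
      (gammaTwo_equivariant (σ₁ := σ₁) σ₂ B h v A i j)
  have e3 : (∑ t, ∑ i : Fin (k+1), ∑ j : Fin k, if (i.succAbove j : ℕ) < (i : ℕ) then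
        gammaTwo h (Function.update v t (B (v t))) A i j else 0)
      = ∑ i : Fin (k+1), ∑ j : Fin k, if (i.succAbove j : ℕ) < (i : ℕ) then
        ∑ t, gammaTwo h (Function.update v t (B (v t))) A i j else 0 := by
    rw [Finset.sum_comm]
    refine Finset.sum_congr rfl fun i _ => ?_
    rw [Finset.sum_comm]
    refine Finset.sum_congr rfl fun j _ => ?_
    split_ifs <;> simp
  simp only [ite_add_zero, Finset.sum_add_distrib] at e1 e2
  rw [e3, Finset.sum_comm, sub_add_sub_comm (α := Symb m V₁ V₂ k), e1, e2, sub_add_sub_comm (α := Symb m V₁ V₂ k)]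
  rfl

/-- The representation `⊕_k σ^{(k)}(B)` as a linear map. -/
def sigmaTLin (σ₁ : GLm m →ₗ[ℝ] (V₁ →L[ℝ] V₁)) {K : ℕ} (B : GLm m) :
    SymbT m V₁ V₂ K →ₗ[ℝ] SymbT m V₁ V₂ K :=
  LinearMap.pi fun k => sigmaSLin σ₁ σ₂ B ∘ₗ LinearMap.proj k

/-- The total map `γ(h)` as a linear map. -/
def gTotLin {K : ℕ} (γf : ∀ k : ℕ, Dualm m → (Symb m V₁ V₂ (k+1) →ₗ[ℝ] Symb m V₁ V₂ k))
    (h : Dualm m) : SymbT m V₁ V₂ K →ₗ[ℝ] SymbT m V₁ V₂ K where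
  toFun := gTot m V₁ V₂ γf h
  map_add' S T := by
    funext k
    by_cases hk : (k : ℕ) + 1 < K + 1 <;> simp [gTot, hk]
  map_smul' c T := by
    funext k
    by_cases hk : (k : ℕ) + 1 < K + 1
    · simp [gTot, hk]
    · simp only [gTot, hk, dif_neg, not_false_eq_true, Pi.smul_apply]
      exact (smul_zero (A := Symb m V₁ V₂ k) c).symm

/-- The subspace `⊕_{k=0}^K S^k ℝ^m ⊗ Hom(V₁,V₂)` of the model. -/
def spanGenT (m : ℕ) (V₁ V₂ : Type) [NormedAddCommGroup V₁] [NormedSpace ℝ V₁]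
    [NormedAddCommGroup V₂] [NormedSpace ℝ V₂] (K : ℕ) : Submodule ℝ (SymbT m V₁ V₂ K) :=
  Submodule.pi Set.univ fun k => spanGen m V₁ V₂ (k : ℕ)

variable {K : ℕ} {γf : ∀ k : ℕ, Dualm m → (Symb m V₁ V₂ (k+1) →ₗ[ℝ] Symb m V₁ V₂ k)}

lemma gTot_add (hγ : ∀ k : ℕ, gammaProp m V₁ V₂ σ₁ (γf k)) (h h' : Dualm m)
    {T : SymbT m V₁ V₂ K} (hT : T ∈ spanGenT m V₁ V₂ K) :
    gTot m V₁ V₂ γf (h + h') T = gTot m V₁ V₂ γf h T + gTot m V₁ V₂ γf h' T := by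
  funext k
  by_cases hk : (k : ℕ) + 1 < K + 1
  · simp only [gTot, hk, dif_pos, Pi.add_apply]
    exact gamma_add (hγ k) h h' (hT ⟨k + 1, hk⟩ trivial)
  · simp [gTot, hk]

lemma gTot_smul (hγ : ∀ k : ℕ, gammaProp m V₁ V₂ σ₁ (γf k)) (c : ℝ) (h : Dualm m)
    {T : SymbT m V₁ V₂ K} (hT : T ∈ spanGenT m V₁ V₂ K) :
    gTot m V₁ V₂ γf (c • h) T = c • gTot m V₁ V₂ γf h T := by
  funext k
  by_cases hk : (k : ℕ) + 1 < K + 1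
  · simp only [gTot, hk, dif_pos, Pi.smul_apply]
    exact gamma_smul (hγ k) c h (hT ⟨k + 1, hk⟩ trivial)
  · simp only [gTot, hk, dif_neg, not_false_eq_true, Pi.smul_apply]
    exact (smul_zero (A := Symb m V₁ V₂ k) c).symm

lemma gTot_sum_smul (hγ : ∀ k : ℕ, gammaProp m V₁ V₂ σ₁ (γf k)) {ι : Type*} [Fintype ι]
    (c : ι → ℝ) (h : ι → Dualm m) {T : SymbT m V₁ V₂ K} (hT : T ∈ spanGenT m V₁ V₂ K) :
    gTot m V₁ V₂ γf (∑ j, c j • h j) T = ∑ j, c j • gTot m V₁ V₂ γf (h j) T := by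
  let G : Dualm m →ₗ[ℝ] SymbT m V₁ V₂ K :=
    { toFun := fun h => gTot m V₁ V₂ γf h T
      map_add' := fun h h' => gTot_add hγ h h' hT
      map_smul' := fun c h => gTot_smul hγ c h hT }
  change G _ = ∑ j, c j • G (h j)
  simp

lemma gTot_equivariant (hσ₁ : IsLieRep m σ₁) (hγ : ∀ k : ℕ, gammaProp m V₁ V₂ σ₁ (γf k))
    (B : GLm m) (h : Dualm m) {T : SymbT m V₁ V₂ K} (hT : T ∈ spanGenT m V₁ V₂ K) :
    gTot m V₁ V₂ γf h (sigmaT m V₁ V₂ σ₁ σ₂ B T)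
      = sigmaT m V₁ V₂ σ₁ σ₂ B (gTot m V₁ V₂ γf h T) + gTot m V₁ V₂ γf (h.comp B) T := by
  funext k
  by_cases hk : (k : ℕ) + 1 < K + 1
  · simp only [gTot, sigmaT, hk, dif_pos, Pi.add_apply]
    exact gamma_equivariant σ₂ hσ₁ (hγ k) B h (hT ⟨k + 1, hk⟩ trivial)
  · simp only [gTot, sigmaT, hk, dif_neg, not_false_eq_true, Pi.add_apply, add_zero]
    exact ((sigmaSLin σ₁ σ₂ B).map_zero).symm

/-- Contraction of `γ` with a linear map `D` is invariant: `B` may be moved from the covectors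
`εⁱ` to the vectors `eᵢ`. -/
lemma sum_gTot_comp (hγ : ∀ k : ℕ, gammaProp m V₁ V₂ σ₁ (γf k)) (B : GLm m)
    (D : Rm m →ₗ[ℝ] SymbT m V₁ V₂ K) (hD : ∀ X, D X ∈ spanGenT m V₁ V₂ K) :
    ∑ i, gTot m V₁ V₂ γf ((epsD m i).comp B) (D (Pi.single i 1))
      = ∑ i, gTot m V₁ V₂ γf (epsD m i) (D (B (Pi.single i 1))) := by
  have hB : ∀ X : Rm m, X = ∑ j, X j • (Pi.single j 1 : Rm m) := fun X => by
    simpa using (pi_eq_sum_univ' X)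
  have hε : ∀ i, (epsD m i).comp B = ∑ j, B (Pi.single j 1) i • epsD m j := by
    intro i
    ext X
    conv_lhs => rw [hB X]
    simp [epsD, coordD]
    exact Finset.sum_congr rfl fun j _ => by ring
  have hl : ∀ i, D (B (Pi.single i 1)) = ∑ j, B (Pi.single i 1) j • D (Pi.single j 1) := by
    intro i
    conv_lhs => rw [hB (B (Pi.single i 1))]
    simp
  simp only [hε, hl, gTot_sum_smul hγ _ _ (hD _)]
  rw [Finset.sum_comm]
  refine Finset.sum_congr rfl fun i _ => ?_
  change _ = gTotLin γf (epsD m i) _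
  simp only [map_sum, map_smul]
  rfl

lemma sum_gTot_sigmaT (hσ₁ : IsLieRep m σ₁) (hγ : ∀ k : ℕ, gammaProp m V₁ V₂ σ₁ (γf k))
    (B : GLm m) (D : Rm m →ₗ[ℝ] SymbT m V₁ V₂ K) (hD : ∀ X, D X ∈ spanGenT m V₁ V₂ K) :
    ∑ i, gTotLin γf (epsD m i) (sigmaTLin σ₂ σ₁ B (D (Pi.single i 1)))
      = sigmaTLin σ₂ σ₁ B (∑ i, gTotLin γf (epsD m i) (D (Pi.single i 1)))
        + ∑ i, gTotLin γf (epsD m i) (D (B (Pi.single i 1))) := by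
  have h : ∀ i, gTotLin γf (epsD m i) (sigmaTLin σ₂ σ₁ B (D (Pi.single i 1)))
      = sigmaTLin σ₂ σ₁ B (gTotLin γf (epsD m i) (D (Pi.single i 1)))
        + gTot m V₁ V₂ γf ((epsD m i).comp B) (D (Pi.single i 1)) := fun i =>
    gTot_equivariant σ₂ hσ₁ hγ B (epsD m i) (hD (Pi.single i 1))
  simp only [h, Finset.sum_add_distrib, map_sum, sum_gTot_comp hγ B D hD]
  rfl

end SymbolLemmas

section CurvedLemmas

variable {m : ℕ} {P : Type} [NormedAddCommGroup P] [NormedSpace ℝ P]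
  {V W : Type} [NormedAddCommGroup V] [NormedSpace ℝ V] [NormedAddCommGroup W] [NormedSpace ℝ W]

lemma fderiv_mem_of_forall_mem [FiniteDimensional ℝ V] (S : Submodule ℝ V) {f : P → V} {u : P}
    (hf : DifferentiableAt ℝ f u) (hS : ∀ x, f x ∈ S) (X : P) : fderiv ℝ f u X ∈ S := by
  obtain ⟨p, hp⟩ := S.subtype.exists_leftInverse_of_injective S.ker_subtype
  let q : V →L[ℝ] V := LinearMap.toContinuousLinearMap (S.subtype ∘ₗ p)
  have hq : (fun x => q (f x)) = f := by
    funext x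
    have := LinearMap.congr_fun hp ⟨f x, hS x⟩
    exact congrArg Subtype.val this
  have h := (q.hasFDerivAt.comp u hf.hasFDerivAt).fderiv
  have h' : fderiv ℝ f u = q.comp (fderiv ℝ f u) := by
    conv_lhs => rw [← hq]
    exact h
  rw [h']
  exact (p (fderiv ℝ f u X)).2

variable {η : Matrix (Idx m) (Idx m) ℝ → P → P}

lemma LD_linearMap_comp [FiniteDimensional ℝ V] (L : V →ₗ[ℝ] W) {f : P → V}
    (hf : Differentiable ℝ f) (Z : Matrix (Idx m) (Idx m) ℝ) (u : P) :
    LD m P η Z (fun x => L (f x)) u = L (LD m P η Z f u) := by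
  have h := ((LinearMap.toContinuousLinearMap L).hasFDerivAt.comp u (hf u).hasFDerivAt).fderiv
  change fderiv ℝ ((LinearMap.toContinuousLinearMap L) ∘ f) u (η Z u) = _
  rw [h]
  rfl

lemma contDiff_LD (hη : ∀ Z, ContDiff ℝ (⊤ : ℕ∞) (η Z)) {f : P → V}
    (hf : ContDiff ℝ (⊤ : ℕ∞) f) (Z : Matrix (Idx m) (Idx m) ℝ) :
    ContDiff ℝ (⊤ : ℕ∞) (LD m P η Z f) :=
  (hf.fderiv_right (m := (⊤ : ℕ∞)) (by norm_cast)).clm_apply (hη Z)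

/-- The invariant derivative at a point, as a linear map on `𝔤₋₁ ≅ ℝ^m`. -/
def LDLin (hadd : ∀ Z Z' u, η (Z + Z') u = η Z u + η Z' u)
    (hsmul : ∀ (c : ℝ) Z u, η (c • Z) u = c • η Z u) (f : P → V) (u : P) : Rm m →ₗ[ℝ] V where
  toFun X := LD m P η (XMat m X) f u
  map_add' X Y := by
    have : XMat m (X + Y) = XMat m X + XMat m Y := by
      ext (i | i) (j | j) <;> simp [XMat]
    simp [LD, this, hadd]
  map_smul' c X := by
    have : XMat m (c • X) = c • XMat m X := by
      ext (i | i) (j | j) <;> simp [XMat]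
    simp [LD, this, hsmul]

lemma trace_BTilde (B : GLm m) : Matrix.trace (BTilde m B) = 0 := by
  have hm : (m : ℝ) + 1 ≠ 0 := by positivity
  rw [BTilde, LinearMap.trace_eq_matrix_trace ℝ (Pi.basisFun ℝ (Fin m)),
    LinearMap.toMatrix_eq_toMatrix']
  simp [Matrix.trace]
  field_simp
  ring

lemma bracket_BTilde_XMat (B : GLm m) (X : Rm m) :
    BTilde m B * XMat m X - XMat m X * BTilde m B = XMat m (B X) := by
  have hB : ∀ i, ∑ j, LinearMap.toMatrix' (B : (Fin m → ℝ) →ₗ[ℝ] (Fin m → ℝ)) i j * X j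
      = B X i := fun i =>
    congrFun (LinearMap.toMatrix'_mulVec (B : (Fin m → ℝ) →ₗ[ℝ] (Fin m → ℝ)) X) i
  rw [BTilde, XMat, Matrix.fromBlocks_multiply, Matrix.fromBlocks_multiply, XMat]
  ext (i | i) (j | j)
  · simp
  · simp only [Matrix.sub_mul, Matrix.sub_apply, Matrix.fromBlocks_apply₁₂, Matrix.add_apply,
      Matrix.mul_apply (M := LinearMap.toMatrix' _), Matrix.of_apply, hB]
    simp [Matrix.mul_apply, Matrix.one_apply]
    ring
  · simp
  · simp

/-- A contraction `-2 Σᵢ g i (L_{ω^{-1}(eᵢ)} f)` with linear maps `g i` whose commutator with `τ`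
is given by the action of `B` on `𝔤₋₁` transforms under `B̃` by `-τ` if `f` does. -/
lemma LD_BTilde_contraction [FiniteDimensional ℝ V] (hη : ∀ Z, ContDiff ℝ (⊤ : ℕ∞) (η Z))
    (hadd : ∀ Z Z' u, η (Z + Z') u = η Z u + η Z' u)
    (hsmul : ∀ (c : ℝ) Z u, η (c • Z) u = c • η Z u) (hbr : BracketCompat m P η)
    {f : P → V} (hf : ContDiff ℝ (⊤ : ℕ∞) f) {S : Submodule ℝ V} (hS : ∀ u, f u ∈ S)
    (B : GLm m) (τ : V →ₗ[ℝ] V) (hfτ : LD m P η (BTilde m B) f = fun u => -(τ (f u)))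
    (g : Fin m → V →ₗ[ℝ] V)
    (hg : ∀ D : Rm m →ₗ[ℝ] V, (∀ X, D X ∈ S) → ∑ i, g i (τ (D (Pi.single i 1)))
      = τ (∑ i, g i (D (Pi.single i 1))) + ∑ i, g i (D (B (Pi.single i 1)))) (u : P) :
    LD m P η (BTilde m B)
        (fun u => (-2 : ℝ) • ∑ i, g i (LD m P η (XMat m (Pi.single i 1)) f u)) u
      = -(τ ((-2 : ℝ) • ∑ i, g i (LD m P η (XMat m (Pi.single i 1)) f u))) := by
  have hfd : Differentiable ℝ f := hf.differentiable (by simp)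
  have hLD : ∀ Z, Differentiable ℝ (LD m P η Z f) := fun Z =>
    (contDiff_LD hη hf Z).differentiable (by simp)
  have hcomm : ∀ i, LD m P η (BTilde m B) (LD m P η (XMat m (Pi.single i 1)) f) u
      = -τ (LD m P η (XMat m (Pi.single i 1)) f u)
        + LD m P η (XMat m (B (Pi.single i 1))) f u := by
    intro i
    have h := congrFun (hbr V f hf (BTilde m B) (XMat m (Pi.single i 1))
      (trace_BTilde B) (by simp [XMat, Matrix.trace]) (by simp [BTilde])
      (by simp [inGm1, XMat])) u
    rw [bracket_BTilde_XMat, hfτ, Pi.sub_apply, sub_eq_iff_eq_add'] at h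
    rw [h]
    congr 1
    exact LD_linearMap_comp (-τ) hfd _ u
  have hd : HasFDerivAt
      (fun u => (-2 : ℝ) • ∑ i, g i (LD m P η (XMat m (Pi.single i 1)) f u))
      ((-2 : ℝ) • ∑ i, (LinearMap.toContinuousLinearMap (g i)).comp
        (fderiv ℝ (LD m P η (XMat m (Pi.single i 1)) f) u)) u :=
    (HasFDerivAt.fun_sum fun i _ => (LinearMap.toContinuousLinearMap
      (g i)).hasFDerivAt.comp u (hLD _ u).hasFDerivAt).const_smul (-2 : ℝ)
  have hsum : LD m P η (BTilde m B)
        (fun u => (-2 : ℝ) • ∑ i, g i (LD m P η (XMat m (Pi.single i 1)) f u)) u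
      = (-2 : ℝ) • ∑ i, g i
          (LD m P η (BTilde m B) (LD m P η (XMat m (Pi.single i 1)) f) u) := by
    change fderiv ℝ _ u _ = _
    rw [hd.fderiv]
    simp only [smul_apply, sum_apply]
    rfl
  have h : ∑ i, g i (τ (LD m P η (XMat m (Pi.single i 1)) f u))
      = τ (∑ i, g i (LD m P η (XMat m (Pi.single i 1)) f u))
        + ∑ i, g i (LD m P η (XMat m (B (Pi.single i 1))) f u) :=
    hg (LDLin hadd hsmul f u) fun X => fderiv_mem_of_forall_mem S (hfd u) hS _
  rw [hsum]
  simp only [hcomm, map_add, map_neg, Finset.sum_add_distrib, Finset.sum_neg_distrib, map_smul]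
  rw [h, neg_add, neg_add_cancel_right, smul_neg]

end CurvedLemmas

/-- the curved operator `N^ω = -2 Σᵢ γ(εⁱ)∘L_{ω^{-1}(eᵢ)}` preserves
infinitesimal `G₀`-equivariance. -/
theorem statement17 (m K : ℕ) (hm : 2 ≤ m)
    (V₁ V₂ : Type) [NormedAddCommGroup V₁] [NormedSpace ℝ V₁] [FiniteDimensional ℝ V₁]
    [NormedAddCommGroup V₂] [NormedSpace ℝ V₂] [FiniteDimensional ℝ V₂]
    (σ₁ : GLm m →ₗ[ℝ] (V₁ →L[ℝ] V₁)) (hσ₁ : IsLieRep m σ₁)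
    (σ₂ : GLm m →ₗ[ℝ] (V₂ →L[ℝ] V₂)) (hσ₂ : IsLieRep m σ₂)
    (γf : ∀ k : ℕ, Dualm m → (Symb m V₁ V₂ (k+1) →ₗ[ℝ] Symb m V₁ V₂ k))
    (hγ : ∀ k : ℕ, gammaProp m V₁ V₂ σ₁ (γf k))
    (P : Type) [NormedAddCommGroup P] [NormedSpace ℝ P] [FiniteDimensional ℝ P]
    (hdim : Module.finrank ℝ P = (m+1)^2 - 1)
    (η : Matrix (Idx m) (Idx m) ℝ → P → P)
    (hηsm : ∀ Z, ContDiff ℝ (⊤ : ℕ∞) (η Z))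
    (hηadd : ∀ Z Z' u, η (Z + Z') u = η Z u + η Z' u)
    (hηsmul : ∀ (c : ℝ) Z u, η (c • Z) u = c • η Z u)
    (hbr : BracketCompat m P η)
    (f : P → SymbT m V₁ V₂ K) (hf : ContDiff ℝ (⊤ : ℕ∞) f)
    (hfval : ∀ u (k : Fin (K+1)), f u k ∈ spanGen m V₁ V₂ (k : ℕ))
    (hfeq : equivG0 m P η (fun B S => sigmaT m V₁ V₂ σ₁ σ₂ B S) f) :
    equivG0 m P η (fun B S => sigmaT m V₁ V₂ σ₁ σ₂ B S) (Nom m P V₁ V₂ γf η f) := by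
  intro B
  funext u
  exact LD_BTilde_contraction (V := SymbT m V₁ V₂ K) hηsm hηadd hηsmul hbr hf
    (S := spanGenT m V₁ V₂ K) (fun x k _ => hfval x k) B (sigmaTLin σ₂ σ₁ B) (hfeq B)
    (fun i => gTotLin γf (epsD m i)) (sum_gTot_sigmaT σ₂ hσ₁ hγ B) u

end ProjQuant
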